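/- arXiv:1908.09175 — 3 statements merged into one kernel-verified Lean document; each statement's English description precedes it below -/
import Mathlib

section
/- Hyperbolic-plane core of Lemma 3.1 (the 3-dimensional lemma reduces to this planar statement): let g₁, g₂, g₃ ∈ SL(2,ℝ) be such that the closed half-planes g₁ • H, g₂ • H, g₃ • H of ℍ are pairwise disjoint. Then for every x ∈ g₁ • L_0, every x' ∈ g₂ • L_0, and every y ∈ g₃ • L_0, either dist(x, y) ≥ arsinh 1 or dist(x', y) ≥ arsinh 1 (here arsinh 1 = arcosh √2 = log(1 + √2) is the constant w₀ of the paper). -/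
open UpperHalfPlane Pointwise

/-- The vertical geodesic `{z ∈ ℍ : Re z = a}`. -/
def vertGeodesic (a : ℝ) : Set UpperHalfPlane := {z | z.re = a}

/-- The closed half-plane `{z ∈ ℍ : Re z ≤ 0}`, with boundary geodesic `vertGeodesic 0`. -/
def closedHalfPlane : Set UpperHalfPlane := {z | z.re ≤ 0}

/-- The sign of the real part of `h • z` is the sign of a real quadratic form of
discriminant one, evaluated at `z`. -/
theorem re_specialLinearGroup_smul (h : Matrix.SpecialLinearGroup (Fin 2) ℝ)
    (z : UpperHalfPlane) :
    ∃ r : ℝ, 0 < r ∧ h 0 0 * h 1 0 * (z.re ^ 2 + z.im ^ 2)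
      + (h 0 0 * h 1 1 + h 0 1 * h 1 0) * z.re + h 0 1 * h 1 1 = r * (h • z).re := by
  have hne : Complex.normSq ((h 1 0 : ℂ) * z + h 1 1) ≠ 0 := by
    have := UpperHalfPlane.denom_ne_zero (h : GL (Fin 2) ℝ) z
    simpa [UpperHalfPlane.denom] using this
  refine ⟨Complex.normSq ((h 1 0 : ℂ) * z + h 1 1),
    lt_of_le_of_ne (Complex.normSq_nonneg _) (Ne.symm hne), ?_⟩
  have hre : (h • z).re = (((h 0 0 : ℂ) * z + h 0 1) / ((h 1 0 : ℂ) * z + h 1 1)).re := by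
    rw [← UpperHalfPlane.coe_re, UpperHalfPlane.coe_specialLinearGroup_apply]
    simp
  rw [hre, Complex.div_re]
  field_simp
  simp
  ring

/-- A half-plane is the sublevel set of a real quadratic form of discriminant one, and its
boundary geodesic is the zero set. -/
theorem exists_quadratic_form_halfPlane (g : Matrix.SpecialLinearGroup (Fin 2) ℝ) :
    ∃ A B C : ℝ, B ^ 2 - 4 * A * C = 1 ∧
      (∀ z : UpperHalfPlane, z ∈ g • closedHalfPlane ↔
        A * (z.re ^ 2 + z.im ^ 2) + B * z.re + C ≤ 0) ∧
      (∀ z : UpperHalfPlane, z ∈ g • vertGeodesic 0 →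
        A * (z.re ^ 2 + z.im ^ 2) + B * z.re + C = 0) := by
  have hdet := (g⁻¹).det_coe
  rw [Matrix.det_fin_two] at hdet
  generalize hh : g⁻¹ = h at hdet
  refine ⟨h 0 0 * h 1 0, h 0 0 * h 1 1 + h 0 1 * h 1 0, h 0 1 * h 1 1, ?_, fun z => ?_,
    fun z hz => ?_⟩
  · linear_combination (h 0 0 * h 1 1 - h 0 1 * h 1 0 + 1) * hdet
  · obtain ⟨r, hr, e⟩ := re_specialLinearGroup_smul h z
    rw [Set.mem_smul_set_iff_inv_smul_mem, hh, e]
    change (h • z).re ≤ 0 ↔ _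
    constructor <;> intro hz <;> nlinarith
  · obtain ⟨r, hr, e⟩ := re_specialLinearGroup_smul h z
    rw [Set.mem_smul_set_iff_inv_smul_mem, hh] at hz
    rw [e, show (h • z).re = 0 from hz, mul_zero]

/-- The hyperbolic distance from `i t` to a point of the geodesic cut out by a quadratic form of
discriminant one controls the value of the form at `i t`. -/
theorem quadratic_form_lt_of_dist_lt {A B C : ℝ} (hdisc : B ^ 2 - 4 * A * C = 1)
    {x y : UpperHalfPlane} (hx : A * (x.re ^ 2 + x.im ^ 2) + B * x.re + C = 0) (hy : y.re = 0)
    (hd : dist x y < Real.arsinh 1) : A * y.im ^ 2 + C < y.im := by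
  have hv := x.im_pos
  have ht := y.im_pos
  have hs : Real.sinh (dist x y) < 1 := by
    simpa [Real.sinh_arsinh] using Real.sinh_lt_sinh.2 hd
  have hs0 : 0 ≤ Real.sinh (dist x y) := Real.sinh_nonneg_iff.2 dist_nonneg
  have hc := UpperHalfPlane.cosh_dist x y
  have hcs := Real.cosh_sq (dist x y)
  rw [Complex.dist_eq, Complex.sq_norm, Complex.normSq_apply] at hc
  simp only [Complex.sub_re, Complex.sub_im, UpperHalfPlane.coe_re, UpperHalfPlane.coe_im, hy]
    at hc
  generalize Real.sinh (dist x y) = s at *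
  generalize Real.cosh (dist x y) = c at *
  generalize x.re = u at *
  generalize x.im = v at *
  generalize y.im = t at *
  have hc' : u ^ 2 + v ^ 2 + t ^ 2 = 2 * v * t * c := by
    rw [hc]; field_simp; ring
  have key : 4 * v ^ 2 * (A * t ^ 2 + C) ^ 2 ≤ (u ^ 2 + v ^ 2 + t ^ 2) ^ 2 - 4 * v ^ 2 * t ^ 2 := by
    have e : (u ^ 2 + v ^ 2 + t ^ 2) ^ 2 - 4 * v ^ 2 * t ^ 2 - 4 * v ^ 2 * (A * t ^ 2 + C) ^ 2
        = (B * (t ^ 2 - (u ^ 2 + v ^ 2)) + 2 * u * (A * t ^ 2 - C)) ^ 2 := by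
      linear_combination (4 * t ^ 2 * (B * u - A * (u ^ 2 + v ^ 2) - C)
        - 4 * (t ^ 2 - (u ^ 2 + v ^ 2)) * (A * t ^ 2 - C)) * hx
        - ((u ^ 2 + v ^ 2 + t ^ 2) ^ 2 - 4 * v ^ 2 * t ^ 2) * hdisc
    nlinarith [sq_nonneg (B * (t ^ 2 - (u ^ 2 + v ^ 2)) + 2 * u * (A * t ^ 2 - C))]
  have key' : (A * t ^ 2 + C) ^ 2 ≤ (t * s) ^ 2 := by
    rw [hc'] at key
    have : 4 * v ^ 2 * (A * t ^ 2 + C) ^ 2 ≤ 4 * v ^ 2 * (t * s) ^ 2 := by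
      linear_combination key + 4 * v ^ 2 * t ^ 2 * hcs
    exact le_of_mul_le_mul_left this (by positivity)
  have := abs_le_of_sq_le_sq' key' (by positivity)
  nlinarith [this.2]

/-- A quadratic form of discriminant one which is positive on the closed half-plane
`Re z ≤ 0` has linear coefficient at most `-1`. -/
theorem linear_coeff_le_neg_one_of_pos {A B C : ℝ} (hdisc : B ^ 2 - 4 * A * C = 1)
    (hpos : ∀ z : UpperHalfPlane, z.re ≤ 0 →
      0 < A * (z.re ^ 2 + z.im ^ 2) + B * z.re + C) : B ≤ -1 := by
  have hpos' : ∀ u v : ℝ, 0 < v → u ≤ 0 → 0 < A * (u ^ 2 + v ^ 2) + B * u + C :=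
    fun u v hv hu => hpos ⟨⟨u, v⟩, hv⟩ hu
  have hA : 0 ≤ A := by
    by_contra! hA
    have hq : 0 ≤ |C| / -A := div_nonneg (abs_nonneg C) (by linarith)
    have h1 := hpos' 0 (1 + |C| / -A) (by linarith) le_rfl
    have h2 : -A * (|C| / -A) = |C| := mul_div_cancel₀ _ (by linarith)
    nlinarith [le_abs_self C, sq_nonneg (|C| / -A)]
  have hC : 0 ≤ C := by
    by_contra! hC
    have hT : 0 < -C / (A - C) := div_pos (by linarith) (by linarith)
    have hT1 : -C / (A - C) ≤ 1 := (div_le_one (by linarith)).2 (by linarith)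
    have h1 := hpos' 0 _ hT le_rfl
    have h2 : (A - C) * (-C / (A - C)) = -C := mul_div_cancel₀ _ (by linarith)
    generalize -C / (A - C) = T at *
    nlinarith [mul_nonneg (mul_nonneg hA hT.le) (sub_nonneg.2 hT1)]
  have hB : B < 0 := by
    by_contra! hB
    rcases hA.eq_or_lt with rfl | hA
    · have h1 := hpos' (-C) 1 one_pos (by linarith)
      nlinarith
    · have h1 := hpos' (-(B / (2 * A))) (1 / (2 * A)) (by positivity)
        (neg_nonpos.2 (by positivity))
      have h2 : A * ((-(B / (2 * A))) ^ 2 + (1 / (2 * A)) ^ 2) + B * -(B / (2 * A)) + C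
          = (1 - (B ^ 2 - 4 * A * C)) / (4 * A) := by
        field_simp; ring
      rw [h2, hdisc] at h1
      simp at h1
  nlinarith [mul_nonneg hA hC]

/-- If a half-plane disjoint from `Re z ≤ 0` has a boundary point at distance less than `arsinh 1`
from `i t`, then it contains all points `t + i ε` with `ε > 0` small. -/
theorem eventually_mem_halfPlane_of_dist_lt {g : Matrix.SpecialLinearGroup (Fin 2) ℝ}
    (hg : Disjoint (g • closedHalfPlane) closedHalfPlane) {x y : UpperHalfPlane}
    (hx : x ∈ g • vertGeodesic 0) (hy : y.re = 0) (hd : dist x y < Real.arsinh 1) :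
    ∀ᶠ ε in nhds (0 : ℝ), ∀ hε : 0 < ε,
      (⟨⟨y.im, ε⟩, hε⟩ : UpperHalfPlane) ∈ g • closedHalfPlane := by
  obtain ⟨A, B, C, hdisc, hmem, hbd⟩ := exists_quadratic_form_halfPlane g
  have hlt := quadratic_form_lt_of_dist_lt hdisc (hbd x hx) hy hd
  have hB : B ≤ -1 := linear_coeff_le_neg_one_of_pos hdisc fun z hz => by
    by_contra! hle
    exact Set.disjoint_left.1 hg ((hmem z).2 hle) hz
  have ht := y.im_pos
  have hAC : A * y.im ^ 2 + B * y.im + C < 0 := by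
    nlinarith
  have hcont : Continuous fun ε : ℝ => A * (y.im ^ 2 + ε ^ 2) + B * y.im + C := by fun_prop
  have hev := hcont.continuousAt.eventually_lt (continuousAt_const (y := (0 : ℝ)) (x := (0 : ℝ)))
    (by simpa using hAC)
  filter_upwards [hev] with ε h hε
  exact (hmem _).2 h.le

/-- Hyperbolic-plane core of Lemma 3.1: if three closed half-planes of ℍ are pairwise
disjoint, then for points `x`, `x'`, `y` on the boundary geodesics of the first, second and
third half-plane respectively, `dist x y ≥ arsinh 1` or `dist x' y ≥ arsinh 1`. -/
theorem stmt_0 (g₁ g₂ g₃ : Matrix.SpecialLinearGroup (Fin 2) ℝ)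
    (h12 : Disjoint (g₁ • closedHalfPlane) (g₂ • closedHalfPlane))
    (h13 : Disjoint (g₁ • closedHalfPlane) (g₃ • closedHalfPlane))
    (h23 : Disjoint (g₂ • closedHalfPlane) (g₃ • closedHalfPlane))
    (x x' y : UpperHalfPlane)
    (hx : x ∈ g₁ • vertGeodesic 0) (hx' : x' ∈ g₂ • vertGeodesic 0)
    (hy : y ∈ g₃ • vertGeodesic 0) :
    Real.arsinh 1 ≤ dist x y ∨ Real.arsinh 1 ≤ dist x' y := by
  by_contra! hcon
  have hy0 : (g₃⁻¹ • y).re = 0 := Set.mem_smul_set_iff_inv_smul_mem.1 hy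
  have near : ∀ (g : Matrix.SpecialLinearGroup (Fin 2) ℝ) (w : UpperHalfPlane),
      Disjoint (g • closedHalfPlane) (g₃ • closedHalfPlane) → w ∈ g • vertGeodesic 0 →
      dist w y < Real.arsinh 1 → ∀ᶠ ε in nhds (0 : ℝ), ∀ hε : 0 < ε,
        (⟨⟨(g₃⁻¹ • y).im, ε⟩, hε⟩ : UpperHalfPlane) ∈ (g₃⁻¹ * g) • closedHalfPlane := by
    intro g w hg hw hd
    refine eventually_mem_halfPlane_of_dist_lt (x := g₃⁻¹ • w) ?_ ?_ hy0 ?_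
    · rw [mul_smul]
      simpa using (Set.disjoint_smul_set (a := g₃⁻¹)).2 hg
    · rw [mul_smul]
      exact Set.smul_mem_smul_set hw
    · rwa [dist_smul]
  obtain ⟨ε, ⟨h1, h2⟩, hε⟩ := ((((near g₁ x h13 hx hcon.1).and
    (near g₂ x' h23 hx' hcon.2)).filter_mono nhdsWithin_le_nhds).and
      (self_mem_nhdsWithin (s := Set.Ioi (0 : ℝ)))).exists
  have hd : Disjoint ((g₃⁻¹ * g₁) • closedHalfPlane) ((g₃⁻¹ * g₂) • closedHalfPlane) := by
    rw [mul_smul, mul_smul]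
    exact Set.disjoint_smul_set.2 h12
  exact Set.disjoint_left.1 hd (h1 hε) (h2 hε)
end

section
/- Sharpness of the constant w₀ = arcosh √2 in Lemma 3.1: in ℍ one has dist(i, 1 + √2·i) = arsinh 1 and Metric.infDist i L_1 = arsinh 1; i.e. for the ideal triangle with vertices −1, 1, ∞, the point i on the side {|z| = 1} is at hyperbolic distance exactly arsinh 1 = arcosh √2 = log(1 + √2) from the side L_1, with nearest point 1 + √2·i. -/
open UpperHalfPlane

/-- The point `1 + √2·i` of the upper half-plane. -/
noncomputable def ptOneSqrtTwo : UpperHalfPlane :=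
  ⟨⟨1, Real.sqrt 2⟩, by norm_num [Real.sqrt_pos]⟩

theorem cosh_arsinh_one : Real.cosh (Real.arsinh 1) = √2 := by
  rw [Real.cosh_arsinh]
  norm_num

theorem cosh_dist_I_of_re_eq_one {w : UpperHalfPlane} (hw : w.re = 1) :
    Real.cosh (dist UpperHalfPlane.I w) = (2 + w.im ^ 2) / (2 * w.im) := by
  rw [UpperHalfPlane.cosh_dist', hw, UpperHalfPlane.I_re, UpperHalfPlane.I_im]
  ring

theorem arsinh_one_le_dist_I_of_re_eq_one {w : UpperHalfPlane} (hw : w.re = 1) :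
    Real.arsinh 1 ≤ dist UpperHalfPlane.I w := by
  have h0 : 0 ≤ Real.arsinh 1 := Real.arsinh_nonneg_iff.2 zero_le_one
  rw [← abs_of_nonneg h0, ← abs_of_nonneg (dist_nonneg (x := UpperHalfPlane.I) (y := w)),
    ← Real.cosh_le_cosh, cosh_arsinh_one, cosh_dist_I_of_re_eq_one hw,
    le_div_iff₀ (by linarith [w.im_pos])]
  nlinarith [sq_nonneg (w.im - √2), Real.sq_sqrt (zero_le_two (α := ℝ))]

theorem dist_I_ptOneSqrtTwo : dist UpperHalfPlane.I ptOneSqrtTwo = Real.arsinh 1 := by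
  have h0 : 0 ≤ Real.arsinh 1 := Real.arsinh_nonneg_iff.2 zero_le_one
  have him : ptOneSqrtTwo.im = √2 := rfl
  refine Real.cosh_strictMonoOn.injOn dist_nonneg h0 ?_
  rw [cosh_arsinh_one, cosh_dist_I_of_re_eq_one rfl, him, div_eq_iff (by positivity)]
  linarith [Real.mul_self_sqrt (zero_le_two (α := ℝ)), Real.sq_sqrt (zero_le_two (α := ℝ))]

/-- Sharpness of the constant `w₀ = arcosh √2 = arsinh 1` in Lemma 3.1: the point `i` on the
side `{|z| = 1}` of the ideal triangle with vertices `-1`, `1`, `∞` is at hyperbolic distance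
exactly `arsinh 1` from the side `L_1`, with nearest point `1 + √2·i`. -/
theorem stmt_2 :
    dist UpperHalfPlane.I ptOneSqrtTwo = Real.arsinh 1 ∧
    Metric.infDist UpperHalfPlane.I (vertGeodesic 1) = Real.arsinh 1 := by
  have hmem : ptOneSqrtTwo ∈ vertGeodesic 1 := rfl
  refine ⟨dist_I_ptOneSqrtTwo, le_antisymm ?_ ?_⟩
  · exact dist_I_ptOneSqrtTwo ▸ Metric.infDist_le_dist_of_mem hmem
  · exact (Metric.le_infDist ⟨_, hmem⟩).2 fun _ hw => arsinh_one_le_dist_I_of_re_eq_one hw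
end

section
/- Hyperbolic-plane core of Lemma 3.2 (first assertion): let g₁, g₂, g₃ ∈ SL(2,ℝ) be such that g₁ • H is disjoint from g₃ • H and g₂ • H is disjoint from g₃ • H. If there exist points x ∈ g₁ • L_0, x' ∈ g₂ • L_0 and y ∈ g₃ • L_0 with dist(x, y) < arsinh 1 and dist(x', y) < arsinh 1, then the half-planes g₁ • H and g₂ • H intersect: (g₁ • H) ∩ (g₂ • H) ≠ ∅. -/
open UpperHalfPlane Pointwise

/-- The sign of `Re (k • z)` is that of a quadratic form of discriminant one. -/
theorem exists_re_smul_mul_eq (k : Matrix.SpecialLinearGroup (Fin 2) ℝ) :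
    ∃ A B C : ℝ, B ^ 2 - 4 * A * C = 1 ∧ ∀ z : UpperHalfPlane, ∃ D : ℝ, 0 < D ∧
      (k • z).re * D = A * (z.re ^ 2 + z.im ^ 2) + B * z.re + C := by
  refine ⟨k 0 0 * k 1 0, k 0 0 * k 1 1 + k 0 1 * k 1 0, k 0 1 * k 1 1, ?_, fun z => ?_⟩
  · have h := k.det_coe
    rw [Matrix.det_fin_two] at h
    linear_combination (k 0 0 * k 1 1 - k 0 1 * k 1 0 + 1) * h
  · have hne : (k 1 0 : ℂ) * z + k 1 1 ≠ 0 :=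
      UpperHalfPlane.denom_ne_zero k z
    refine ⟨Complex.normSq ((k 1 0 : ℂ) * z + k 1 1), Complex.normSq_pos.2 hne, ?_⟩
    have hre : (k • z).re = (((k 0 0 : ℂ) * z + k 0 1) / ((k 1 0 : ℂ) * z + k 1 1)).re := by
      rw [UpperHalfPlane.specialLinearGroup_apply]
      rfl
    rw [hre, Complex.div_re, ← add_div, div_mul_cancel₀ _ (Complex.normSq_pos.2 hne).ne']
    simp
    ring

/-- A quadratic form of discriminant one that is positive on `{Re z ≤ 0}` has nonnegative outer
coefficients and middle coefficient at most `-1`. -/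
theorem coeff_bounds_of_pos {A B C : ℝ} (hdisc : B ^ 2 - 4 * A * C = 1)
    (hpos : ∀ u v : ℝ, u ≤ 0 → 0 < v → 0 < A * (u ^ 2 + v ^ 2) + B * u + C) :
    0 ≤ A ∧ 0 ≤ C ∧ B ≤ -1 := by
  have hA : 0 ≤ A := by
    by_contra! h
    have h2 : 0 ≤ |C| / (-A) := div_nonneg (abs_nonneg _) (by linarith)
    have h1 := hpos 0 (1 + |C| / (-A)) le_rfl (by linarith)
    have h3 : |C| / (-A) * A = -|C| := by
      rw [div_neg, neg_mul, div_mul_cancel₀ _ h.ne]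
    nlinarith [le_abs_self C, mul_nonneg h2 h2, mul_nonneg (mul_nonneg h2 h2) (neg_pos.2 h).le]
  have hC : 0 ≤ C := by
    by_contra! h
    have hd : 0 < -C / (A + 1 - C) := div_pos (by linarith) (by linarith)
    have h1 := hpos 0 (-C / (A + 1 - C)) le_rfl hd
    have h2 : -C / (A + 1 - C) < 1 := by rw [div_lt_one (by linarith)]; linarith
    have h3 : -C / (A + 1 - C) * (A + 1 - C) = -C := div_mul_cancel₀ _ (by linarith)
    nlinarith [mul_nonneg hA hd.le]
  refine ⟨hA, hC, ?_⟩
  have hAC : 0 ≤ A * C := mul_nonneg hA hC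
  by_contra! h
  have hB : 1 ≤ B := by nlinarith
  rcases hA.eq_or_lt with rfl | hA'
  · have := hpos (-(C + 1)) 1 (by linarith) one_pos
    nlinarith
  · have h1 := hpos (-(B / (2 * A))) (1 / (2 * A)) (by
      have : 0 ≤ B / (2 * A) := by positivity
      linarith) (by positivity)
    have h2 : A * ((-(B / (2 * A))) ^ 2 + (1 / (2 * A)) ^ 2) + B * -(B / (2 * A)) + C
        = (1 - (B ^ 2 - 4 * A * C)) / (4 * A) := by
      field_simp
      ring
    rw [h2, hdisc] at h1
    simp at h1

/-- If a geodesic meets the ball of radius `arsinh 1` around `i t`, the associated normalised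
quadratic form is less than `1` in absolute value at `i t`. -/
theorem sq_lt_of_dist_lt {A B C : ℝ} (hdisc : B ^ 2 - 4 * A * C = 1) {w y : UpperHalfPlane}
    (hy : y.re = 0) (hw : A * (w.re ^ 2 + w.im ^ 2) + B * w.re + C = 0)
    (hd : dist w y < Real.arsinh 1) : (A * y.im ^ 2 + C) ^ 2 < y.im ^ 2 := by
  have hv := w.im_pos
  have ht := y.im_pos
  have hcosh : Real.cosh (dist w y) < √2 := by
    have h : Real.cosh (Real.arsinh 1) = √2 := by
      rw [Real.cosh_arsinh]; norm_num
    rw [← h, Real.cosh_lt_cosh, abs_of_nonneg dist_nonneg]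
    exact hd.trans_le (le_abs_self _)
  rw [UpperHalfPlane.cosh_dist', hy, div_lt_iff₀ (by positivity)] at hcosh
  set u := w.re
  set v := w.im
  set t := y.im
  have hP : (u ^ 2 + v ^ 2 + t ^ 2) ^ 2 < 8 * v ^ 2 * t ^ 2 := by
    have h2 : √2 ^ 2 = (2 : ℝ) := Real.sq_sqrt (by norm_num)
    calc (u ^ 2 + v ^ 2 + t ^ 2) ^ 2 < (√2 * (2 * v * t)) ^ 2 :=
          pow_lt_pow_left₀ (by linarith) (by positivity) two_ne_zero
      _ = 8 * v ^ 2 * t ^ 2 := by rw [mul_pow, h2]; ring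
  have hcs : (A * t ^ 2 + C) ^ 2 * (u ^ 2 + v ^ 2 + t ^ 2) ^ 2 ≤
      ((A * t ^ 2 - C) ^ 2 + (B * t) ^ 2) * ((u ^ 2 + v ^ 2 - t ^ 2) ^ 2 + (2 * u * t) ^ 2) := by
    have h : (A * t ^ 2 + C) * (u ^ 2 + v ^ 2 + t ^ 2) =
        -((A * t ^ 2 - C) * (u ^ 2 + v ^ 2 - t ^ 2) + B * t * (2 * u * t)) := by
      linear_combination 2 * t ^ 2 * hw
    rw [← mul_pow, h]
    nlinarith [sq_nonneg ((A * t ^ 2 - C) * (2 * u * t) - B * t * (u ^ 2 + v ^ 2 - t ^ 2))]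
  have h1 : (A * t ^ 2 - C) ^ 2 + (B * t) ^ 2 = (A * t ^ 2 + C) ^ 2 + t ^ 2 := by
    linear_combination t ^ 2 * hdisc
  have h2 : (u ^ 2 + v ^ 2 - t ^ 2) ^ 2 + (2 * u * t) ^ 2 =
      (u ^ 2 + v ^ 2 + t ^ 2) ^ 2 - 4 * v ^ 2 * t ^ 2 := by ring
  rw [h1, h2] at hcs
  have h3 : t ^ 2 * (u ^ 2 + v ^ 2 + t ^ 2) ^ 2 < t ^ 2 * (8 * v ^ 2 * t ^ 2) :=
    mul_lt_mul_of_pos_left hP (by positivity)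
  have h4 : 0 < 4 * v ^ 2 * t ^ 2 := by positivity
  by_contra! h
  nlinarith [mul_le_mul_of_nonneg_right h h4.le]

/-- If `k⁻¹ • H` is disjoint from `H` and its boundary passes within `arsinh 1` of `y ∈ L_0`, then
`k⁻¹ • H` contains all points far enough along the perpendicular to `L_0` at `y`. -/
theorem exists_re_smul_nonpos (k : Matrix.SpecialLinearGroup (Fin 2) ℝ) {w y : UpperHalfPlane}
    (hk : ∀ z : UpperHalfPlane, z.re ≤ 0 → 0 < (k • z).re) (hy : y.re = 0)
    (hw : (k • w).re = 0) (hd : dist w y < Real.arsinh 1) :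
    ∃ m < y.im, 0 ≤ m ∧ ∀ z : UpperHalfPlane, z.re ^ 2 + z.im ^ 2 = y.im ^ 2 → m ≤ z.re →
      (k • z).re ≤ 0 := by
  obtain ⟨A, B, C, hdisc, hq⟩ := exists_re_smul_mul_eq k
  obtain ⟨hA, hC, hB⟩ := coeff_bounds_of_pos hdisc fun u v hu hv => by
    obtain ⟨D, hD, h⟩ := hq ⟨⟨u, v⟩, hv⟩
    have := mul_pos (hk ⟨⟨u, v⟩, hv⟩ hu) hD
    rw [h] at this
    exact this
  have hw' : A * (w.re ^ 2 + w.im ^ 2) + B * w.re + C = 0 := by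
    obtain ⟨D, -, h⟩ := hq w
    rw [← h, hw, zero_mul]
  have hlt := sq_lt_of_dist_lt hdisc hy hw' hd
  refine ⟨A * y.im ^ 2 + C, lt_of_pow_lt_pow_left₀ 2 y.im_pos.le hlt, by positivity,
    fun z hz hm => ?_⟩
  obtain ⟨D, hD, h⟩ := hq z
  have hm0 : 0 ≤ A * y.im ^ 2 + C := by positivity
  rw [hz] at h
  refine nonpos_of_mul_nonpos_left ?_ hD
  nlinarith

/-- Hyperbolic-plane core of Lemma 3.2 (first assertion): if the half-planes `g₁ • H` and
`g₂ • H` are each disjoint from `g₃ • H`, and there are points `x ∈ g₁ • L_0`,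
`x' ∈ g₂ • L_0`, `y ∈ g₃ • L_0` with `dist x y < arsinh 1` and `dist x' y < arsinh 1`,
then `g₁ • H` and `g₂ • H` intersect. -/
theorem stmt_3 (g₁ g₂ g₃ : Matrix.SpecialLinearGroup (Fin 2) ℝ)
    (h13 : Disjoint (g₁ • closedHalfPlane) (g₃ • closedHalfPlane))
    (h23 : Disjoint (g₂ • closedHalfPlane) (g₃ • closedHalfPlane))
    (x x' y : UpperHalfPlane)
    (hx : x ∈ g₁ • vertGeodesic 0) (hx' : x' ∈ g₂ • vertGeodesic 0)
    (hy : y ∈ g₃ • vertGeodesic 0)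
    (hxy : dist x y < Real.arsinh 1) (hx'y : dist x' y < Real.arsinh 1) :
    ((g₁ • closedHalfPlane) ∩ (g₂ • closedHalfPlane)).Nonempty := by
  obtain ⟨y, hy, rfl⟩ := hy
  have key : ∀ (g : Matrix.SpecialLinearGroup (Fin 2) ℝ) (x : UpperHalfPlane),
      Disjoint (g • closedHalfPlane) (g₃ • closedHalfPlane) → x ∈ g • vertGeodesic 0 →
      dist x (g₃ • y) < Real.arsinh 1 →
      ∃ m < y.im, 0 ≤ m ∧ ∀ z : UpperHalfPlane, z.re ^ 2 + z.im ^ 2 = y.im ^ 2 → m ≤ z.re →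
        g₃ • z ∈ g • closedHalfPlane := by
    intro g x hdisj hx hd
    rw [Set.mem_smul_set_iff_inv_smul_mem] at hx
    simp only [Set.mem_smul_set_iff_inv_smul_mem, smul_smul]
    refine exists_re_smul_nonpos (g⁻¹ * g₃) (w := g₃⁻¹ • x) (fun z hz => ?_) hy ?_ ?_
    · by_contra! h
      refine hdisj.notMem_of_mem_right (Set.smul_mem_smul_set hz) ?_
      rw [Set.mem_smul_set_iff_inv_smul_mem, smul_smul]
      exact h
    · rw [smul_smul, mul_inv_cancel_right]
      exact hx
    · rwa [← dist_smul g₃, smul_inv_smul]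
  obtain ⟨m₁, hm₁, hm₁0, h₁⟩ := key g₁ x h13 hx hxy
  obtain ⟨m₂, hm₂, -, h₂⟩ := key g₂ x' h23 hx' hx'y
  have hm : max m₁ m₂ < y.im := max_lt hm₁ hm₂
  have hm0 : 0 ≤ max m₁ m₂ := le_max_of_le_left hm₁0
  have hpos : 0 < y.im ^ 2 - max m₁ m₂ ^ 2 := by nlinarith
  let z : UpperHalfPlane := ⟨⟨max m₁ m₂, √(y.im ^ 2 - max m₁ m₂ ^ 2)⟩, Real.sqrt_pos.2 hpos⟩
  have hz : z.re ^ 2 + z.im ^ 2 = y.im ^ 2 := by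
    change max m₁ m₂ ^ 2 + √(y.im ^ 2 - max m₁ m₂ ^ 2) ^ 2 = y.im ^ 2
    rw [Real.sq_sqrt hpos.le]
    ring
  exact ⟨g₃ • z, h₁ z hz (le_max_left _ _), h₂ z hz (le_max_right _ _)⟩
end
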